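/- arXiv:1605.09081 — 4 statements merged into one kernel-verified Lean document; each statement's English description precedes it below -/
import Mathlib

section
/- Let f : ℝ → ℂ be a Schwartz function, and let f̂ denote its Fourier transform with the convention f̂(ω) = ∫_ℝ f(t) e^{-2πiωt} dt. Then (∫_ℝ t²|f(t)|² dt) · (∫_ℝ ω²|f̂(ω)|² dω) ≥ (1/(16π²)) · (∫_ℝ |f(t)|² dt)², i.e. the product of the time-spread and the frequency-spread of f is bounded below by a positive universal constant times the fourth power of the L² norm of f. -/
open MeasureTheory Real

namespace SchwartzMap

theorem integrable_norm_sq (f : SchwartzMap ℝ ℂ) : Integrable fun t => ‖f t‖ ^ 2 :=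
  (f.memLp 2).integrable_norm_pow two_ne_zero

theorem integrable_real_inner (f g : SchwartzMap ℝ ℂ) :
    Integrable fun t => inner ℝ (f t) (g t) := by
  refine ((((f + g).integrable_norm_sq.sub f.integrable_norm_sq).sub
    g.integrable_norm_sq).div_const 2).congr (.of_forall fun t => ?_)
  have := norm_add_sq_real (f t) (g t)
  simp only [Pi.sub_apply, add_apply]
  linarith

/-- The Cauchy–Schwarz inequality for the real inner product on `L²`. -/
theorem sq_integral_real_inner_le (f g : SchwartzMap ℝ ℂ) :
    (∫ t, inner ℝ (f t) (g t)) ^ 2 ≤ (∫ t, ‖f t‖ ^ 2) * ∫ t, ‖g t‖ ^ 2 := by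
  have hquad (x : ℝ) : 0 ≤ (∫ t, ‖f t‖ ^ 2) * (x * x) + (2 * ∫ t, inner ℝ (f t) (g t)) * x +
      ∫ t, ‖g t‖ ^ 2 := by
    have hexp : (fun t => ‖x • f t + g t‖ ^ 2) = fun t =>
        ‖f t‖ ^ 2 * (x * x) + inner ℝ (f t) (g t) * (2 * x) + ‖g t‖ ^ 2 := by
      ext t
      rw [norm_add_sq_real, norm_smul, inner_smul_left, mul_pow, Real.norm_eq_abs, sq_abs]
      simp only [conj_trivial]
      ring
    have hnonneg : 0 ≤ ∫ t, ‖x • f t + g t‖ ^ 2 := integral_nonneg fun t => sq_nonneg _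
    rw [hexp, integral_add _ g.integrable_norm_sq, integral_add, integral_mul_const,
      integral_mul_const] at hnonneg
    · linarith
    · exact f.integrable_norm_sq.mul_const _
    · exact (f.integrable_real_inner g).mul_const _
    · exact (f.integrable_norm_sq.mul_const _).add ((f.integrable_real_inner g).mul_const _)
  have := discrim_le_zero hquad
  rw [discrim] at this
  linarith

/-- Multiplication by the coordinate on Schwartz space. -/
noncomputable def mulCoord (f : SchwartzMap ℝ ℂ) : SchwartzMap ℝ ℂ :=
  smulLeftCLM ℂ (fun t : ℝ => t) f

theorem mulCoord_apply (f : SchwartzMap ℝ ℂ) (t : ℝ) : f.mulCoord t = t • f t :=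
  smulLeftCLM_apply_apply (by fun_prop) f t

theorem two_mul_integral_inner_mulCoord_deriv (f : SchwartzMap ℝ ℂ) :
    2 * ∫ t, inner ℝ (f.mulCoord t) (derivCLM ℝ ℂ f t) = -∫ t, ‖f t‖ ^ 2 := by
  have hderiv (t : ℝ) : HasDerivAt (fun t => inner ℝ (f.mulCoord t) (f t))
      (‖f t‖ ^ 2 + 2 * inner ℝ (f.mulCoord t) (derivCLM ℝ ℂ f t)) t := by
    have h := (hasDerivAt_id t).mul (f.hasDerivAt t).norm_sq
    convert! h using 1
    · ext s
      simp only [mulCoord_apply, inner_smul_left, real_inner_self_eq_norm_sq, conj_trivial,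
        Pi.mul_apply, id]
    · simp only [mulCoord_apply, inner_smul_left, derivCLM_apply, conj_trivial, id]
      ring
  have hint := (f.mulCoord.integrable_real_inner (derivCLM ℝ ℂ f)).const_mul 2
  have := integral_eq_zero_of_hasDerivAt_of_integrable hderiv (f.integrable_norm_sq.add hint)
    (f.mulCoord.integrable_real_inner f)
  rw [integral_add f.integrable_norm_sq hint, integral_const_mul] at this
  linarith

theorem integral_norm_sq_deriv (f : SchwartzMap ℝ ℂ) :
    ∫ t, ‖derivCLM ℝ ℂ f t‖ ^ 2 =
      4 * π ^ 2 * ∫ ω : ℝ, ω ^ 2 * ‖FourierTransform.fourier (fun t : ℝ => f t) ω‖ ^ 2 := by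
  rw [← integral_norm_sq_fourier, ← integral_const_mul]
  congr 1 with ω
  have h := congrFun (Real.fourier_deriv f.integrable f.differentiable
    (derivCLM ℝ ℂ f).integrable) ω
  rw [fourier_coe]
  change ‖FourierTransform.fourier (deriv f) ω‖ ^ 2 = _
  rw [h, norm_smul, mul_pow]
  simp only [norm_mul, Complex.norm_real, Complex.norm_I, Complex.norm_ofNat, mul_pow,
    Real.norm_eq_abs, sq_abs]
  ring

end SchwartzMap

/-- **Uncertainty principle** (precise form): for a Schwartz function `f : ℝ → ℂ`,
the product of its time-spread `∫ t² |f t|²` and its frequency-spread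
`∫ ω² |𝓕f ω|²` (with convention `𝓕f ω = ∫ f t · e^{-2πiωt} dt`) is at least
`(1/(16π²)) · (∫ |f t|²)²`. -/
theorem uncertainty_principle (f : SchwartzMap ℝ ℂ) :
    (∫ t : ℝ, t ^ 2 * ‖f t‖ ^ 2) *
      (∫ ω : ℝ, ω ^ 2 * ‖FourierTransform.fourier (fun t : ℝ => f t) ω‖ ^ 2) ≥
    (1 / (16 * π ^ 2)) * (∫ t : ℝ, ‖f t‖ ^ 2) ^ 2 := by
  have hcs := f.mulCoord.sq_integral_real_inner_le (SchwartzMap.derivCLM ℝ ℂ f)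
  have hparts := f.two_mul_integral_inner_mulCoord_deriv
  have htime : ∫ t, ‖f.mulCoord t‖ ^ 2 = ∫ t, t ^ 2 * ‖f t‖ ^ 2 := by
    simp only [SchwartzMap.mulCoord_apply, norm_smul, mul_pow, Real.norm_eq_abs, sq_abs]
  rw [htime, f.integral_norm_sq_deriv] at hcs
  have hsq : (∫ t, ‖f t‖ ^ 2) ^ 2 =
      4 * (∫ t, inner ℝ (f.mulCoord t) (SchwartzMap.derivCLM ℝ ℂ f t)) ^ 2 := by
    rw [← neg_sq, ← hparts]
    ring
  rw [ge_iff_le, one_div_mul_eq_div, div_le_iff₀ (by positivity), hsq]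
  linarith
end

section
/- Let φ : ℝⁿ → ℝ be continuously differentiable with ∇φ integrable, and for J ∈ ℤ define the averaging kernel φ_J(u) = 2^{−nJ} φ(2^{−J} u). Then for every x ∈ L²(ℝⁿ) and every translation c ∈ ℝⁿ, ‖(T_c x) ∗ φ_J − x ∗ φ_J‖_{L²} ≤ 2^{−J} |c| · ‖∇φ‖_{L¹} · ‖x‖_{L²}, where (T_c x)(u) = x(u − c) and ∗ is convolution on ℝⁿ. -/
open MeasureTheory

open scoped ENNReal

/-- Unlike `integral_sub`, this needs no integrability: if `f - g` is integrable then either both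
or neither of `f`, `g` are. -/
theorem enorm_integral_sub_integral_le {α E : Type*} [MeasurableSpace α] {μ : Measure α}
    [NormedAddCommGroup E] [NormedSpace ℝ E] {f g : α → E}
    (h : AEStronglyMeasurable (fun a => f a - g a) μ) :
    ‖∫ a, f a ∂μ - ∫ a, g a ∂μ‖ₑ ≤ ∫⁻ a, ‖f a - g a‖ₑ ∂μ := by
  by_cases htop : ∫⁻ a, ‖f a - g a‖ₑ ∂μ = ∞
  · simp [htop]
  have hfg : Integrable (fun a => f a - g a) μ := ⟨h, lt_top_iff_ne_top.2 htop⟩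
  by_cases hg : Integrable g μ
  · have hf : Integrable f μ := (hfg.add hg).congr (.of_forall fun a => by simp)
    rw [← integral_sub hf hg]
    exact enorm_integral_le_lintegral_enorm _
  · have hf : ¬ Integrable f μ := fun hf => hg ((hf.sub hfg).congr (.of_forall fun a => by simp))
    simp [integral_undef hf, integral_undef hg]

/-- Young's convolution inequality `L² ∗ L¹ ⊆ L²` for nonnegative functions. -/
theorem lintegral_convolution_sq_le {G : Type*} [AddGroup G] [MeasurableSpace G]
    [MeasurableAdd₂ G] [MeasurableNeg G] {μ : Measure G} [SFinite μ]
    [μ.IsAddRightInvariant] [μ.IsAddLeftInvariant] [μ.IsNegInvariant]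
    {f g : G → ℝ≥0∞} (hf : AEMeasurable f μ) (hg : Measurable g) :
    ∫⁻ u, (∫⁻ t, f t * g (u - t) ∂μ) ^ (2 : ℝ) ∂μ ≤
      (∫⁻ t, g t ∂μ) ^ (2 : ℝ) * ∫⁻ t, f t ^ (2 : ℝ) ∂μ := by
  have cauchy_schwarz (u : G) : (∫⁻ t, f t * g (u - t) ∂μ) ^ (2 : ℝ) ≤
      (∫⁻ t, g t ∂μ) * ∫⁻ t, f t ^ (2 : ℝ) * g (u - t) ∂μ := by
    have hgu : Measurable fun t => g (u - t) := hg.comp (measurable_const.sub measurable_id)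
    have key := ENNReal.lintegral_mul_le_Lp_mul_Lq μ Real.HolderConjugate.two_two
      (f := fun t => g (u - t) ^ (1 / 2 : ℝ)) (g := fun t => f t * g (u - t) ^ (1 / 2 : ℝ))
      (hgu.pow_const _).aemeasurable (hf.mul (hgu.pow_const _).aemeasurable)
    have sq_sqrt (a : ℝ≥0∞) : (a ^ (1 / 2 : ℝ)) ^ (2 : ℝ) = a := by
      rw [← ENNReal.rpow_mul]; norm_num
    have sqrt_mul (a b : ℝ≥0∞) : a ^ (1 / 2 : ℝ) * (b * a ^ (1 / 2 : ℝ)) = b * a := by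
      rw [mul_left_comm, ← ENNReal.rpow_add_of_nonneg _ _ (by norm_num) (by norm_num)]
      norm_num
    simp only [Pi.mul_apply, ENNReal.mul_rpow_of_nonneg _ _ zero_le_two, sq_sqrt, sqrt_mul,
      lintegral_sub_left_eq_self g u] at key
    calc _ ≤ _ := ENNReal.rpow_le_rpow key zero_le_two
      _ = _ := by rw [ENNReal.mul_rpow_of_nonneg _ _ zero_le_two, sq_sqrt, sq_sqrt]
  have hmeas : AEMeasurable (fun p : G × G => f p.2 ^ (2 : ℝ) * g (p.1 - p.2)) (μ.prod μ) :=
    (hf.pow_const _).comp_snd.mul (hg.comp (measurable_fst.sub measurable_snd)).aemeasurable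
  calc ∫⁻ u, (∫⁻ t, f t * g (u - t) ∂μ) ^ (2 : ℝ) ∂μ
      ≤ ∫⁻ u, (∫⁻ t, g t ∂μ) * ∫⁻ t, f t ^ (2 : ℝ) * g (u - t) ∂μ ∂μ :=
        lintegral_mono cauchy_schwarz
    _ = (∫⁻ t, g t ∂μ) * ∫⁻ u, ∫⁻ t, f t ^ (2 : ℝ) * g (u - t) ∂μ ∂μ :=
        lintegral_const_mul'' _ hmeas.lintegral_prod_right'
    _ = (∫⁻ t, g t ∂μ) * ∫⁻ t, ∫⁻ u, f t ^ (2 : ℝ) * g (u - t) ∂μ ∂μ := by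
        rw [lintegral_lintegral_swap hmeas]
    _ = (∫⁻ t, g t ∂μ) * ∫⁻ t, f t ^ (2 : ℝ) * ∫⁻ u, g u ∂μ ∂μ := by
        congr 1
        refine lintegral_congr fun t => ?_
        rw [lintegral_const_mul _ (show Measurable fun u => g (u - t) from
            hg.comp (measurable_id.sub_const t)), lintegral_sub_right_eq_self g t]
    _ = _ := by
        rw [lintegral_mul_const'' _ (hf.pow_const _), ENNReal.rpow_two]
        ring

/-- The `L¹` modulus of continuity of a `C¹` function is controlled by the `L¹` norm of its
derivative. -/
theorem lintegral_enorm_sub_translate_le {E F : Type*} [NormedAddCommGroup E] [NormedSpace ℝ E]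
    [MeasurableSpace E] [BorelSpace E] [SecondCountableTopology E]
    [NormedAddCommGroup F] [NormedSpace ℝ F] [CompleteSpace F] {μ : Measure E} [SFinite μ]
    [μ.IsAddRightInvariant] {φ : E → F} (hφ : ContDiff ℝ 1 φ) (c : E) :
    ∫⁻ v, ‖φ (v - c) - φ v‖ₑ ∂μ ≤ ‖c‖ₑ * ∫⁻ v, ‖fderiv ℝ φ v‖ₑ ∂μ := by
  have hcont : Continuous (fderiv ℝ φ) := hφ.continuous_fderiv one_ne_zero
  have pointwise (v : E) : ‖φ (v - c) - φ v‖ₑ ≤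
      ∫⁻ s in Set.Ioc (0 : ℝ) 1, ‖fderiv ℝ φ (v - s • c)‖ₑ * ‖c‖ₑ := by
    have hderiv (s : ℝ) : HasDerivAt (fun s : ℝ => φ (v - s • c))
        (fderiv ℝ φ (v - s • c) (-c)) s := by
      refine ((hφ.differentiable one_ne_zero _).hasFDerivAt).comp_hasDerivAt s ?_
      simpa using ((hasDerivAt_id s).smul_const c).const_sub v
    have hint := intervalIntegral.integral_eq_sub_of_hasDerivAt (a := 0) (b := 1)
      (fun s _ => hderiv s) (Continuous.intervalIntegrable (by fun_prop) _ _)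
    rw [intervalIntegral.integral_of_le zero_le_one] at hint
    simp only [one_smul, zero_smul, sub_zero] at hint
    rw [← hint]
    refine (enorm_integral_le_lintegral_enorm _).trans (lintegral_mono fun s => ?_)
    simpa using (fderiv ℝ φ (v - s • c)).le_opENorm (-c)
  have hmeas : Measurable fun p : E × ℝ => ‖fderiv ℝ φ (p.1 - p.2 • c)‖ₑ * ‖c‖ₑ :=
    Continuous.measurable (by fun_prop) |>.mul_const _
  calc ∫⁻ v, ‖φ (v - c) - φ v‖ₑ ∂μ
      ≤ ∫⁻ v, (∫⁻ s in Set.Ioc (0 : ℝ) 1, ‖fderiv ℝ φ (v - s • c)‖ₑ * ‖c‖ₑ) ∂μ :=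
        lintegral_mono pointwise
    _ = ∫⁻ s in Set.Ioc (0 : ℝ) 1, (∫⁻ v, ‖fderiv ℝ φ (v - s • c)‖ₑ * ‖c‖ₑ ∂μ) :=
        lintegral_lintegral_swap hmeas.aemeasurable
    _ = ∫⁻ s in Set.Ioc (0 : ℝ) 1, (∫⁻ v, ‖fderiv ℝ φ v‖ₑ * ‖c‖ₑ ∂μ) :=
        lintegral_congr fun s =>
          lintegral_sub_right_eq_self (fun v => ‖fderiv ℝ φ v‖ₑ * ‖c‖ₑ) (s • c)
    _ = _ := by
        rw [lintegral_const, lintegral_mul_const _ hcont.enorm.measurable]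
        simp [mul_comm]

theorem lintegral_comp_smul {E : Type*} [NormedAddCommGroup E] [NormedSpace ℝ E]
    [MeasurableSpace E] [BorelSpace E] [FiniteDimensional ℝ E] (μ : Measure E)
    [μ.IsAddHaarMeasure] (f : E → ℝ≥0∞) {r : ℝ} (hr : r ≠ 0) :
    ∫⁻ v, f (r • v) ∂μ =
      ENNReal.ofReal |(r ^ Module.finrank ℝ E)⁻¹| * ∫⁻ v, f v ∂μ := by
  rw [← smul_eq_mul, ← lintegral_smul_measure, ← Measure.map_addHaar_smul μ hr]
  exact ((Homeomorph.smulOfNeZero r hr).toMeasurableEquiv.measurableEmbedding.lintegral_map f).symm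

/-- Local translation invariance of averaging at scale `2^J`: if
`φ_J(u) = 2^{-nJ} φ(2^{-J} u)` is the dilated averaging kernel of a `C¹` function
`φ` with integrable gradient, then for every `x ∈ L²(ℝⁿ)` and every translation `c`,
`‖(T_c x) ∗ φ_J − x ∗ φ_J‖_{L²} ≤ 2^{-J} |c| ‖∇φ‖_{L¹} ‖x‖_{L²}`. -/
theorem averaging_local_translation_invariance (n : ℕ)
    (φ : EuclideanSpace ℝ (Fin n) → ℝ) (hφ : ContDiff ℝ 1 φ)
    (hφ' : Integrable (fun u => fderiv ℝ φ u)
      (volume : Measure (EuclideanSpace ℝ (Fin n))))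
    (J : ℤ) (x : EuclideanSpace ℝ (Fin n) → ℝ)
    (hx : MemLp x 2 (volume : Measure (EuclideanSpace ℝ (Fin n))))
    (c : EuclideanSpace ℝ (Fin n)) :
    eLpNorm (fun u =>
        convolution (fun v => x (v - c))
          (fun v => (2 : ℝ) ^ (-(n : ℤ) * J) * φ (((2 : ℝ) ^ (-J) : ℝ) • v))
          (ContinuousLinearMap.mul ℝ ℝ) volume u -
        convolution x
          (fun v => (2 : ℝ) ^ (-(n : ℤ) * J) * φ (((2 : ℝ) ^ (-J) : ℝ) • v))
          (ContinuousLinearMap.mul ℝ ℝ) volume u) 2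
        (volume : Measure (EuclideanSpace ℝ (Fin n))) ≤
      ENNReal.ofReal (((2 : ℝ) ^ (-J) : ℝ) * ‖c‖ * (∫ u, ‖fderiv ℝ φ u‖)) *
        eLpNorm x 2 (volume : Measure (EuclideanSpace ℝ (Fin n))) := by
  set ψ : EuclideanSpace ℝ (Fin n) → ℝ :=
    fun v => (2 : ℝ) ^ (-(n : ℤ) * J) * φ (((2 : ℝ) ^ (-J) : ℝ) • v) with hψ
  have hψc : Continuous ψ := by
    have := hφ.continuous
    fun_prop
  have pointwise (u : EuclideanSpace ℝ (Fin n)) :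
      ‖convolution (fun v => x (v - c)) ψ (ContinuousLinearMap.mul ℝ ℝ) volume u -
        convolution x ψ (ContinuousLinearMap.mul ℝ ℝ) volume u‖ₑ ≤
      ∫⁻ t, ‖x t‖ₑ * ‖ψ (u - t - c) - ψ (u - t)‖ₑ := by
    have htrans : convolution (fun v => x (v - c)) ψ (ContinuousLinearMap.mul ℝ ℝ) volume u =
        ∫ t, x t * ψ (u - t - c) := by
      rw [← integral_sub_right_eq_self (fun t => x t * ψ (u - t - c)) c]
      simp [convolution_def, sub_sub]
    rw [htrans, convolution_def]
    simp only [ContinuousLinearMap.mul_apply', ← enorm_mul, mul_sub]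
    refine enorm_integral_sub_integral_le (.sub ?_ ?_) <;>
      exact hx.aestronglyMeasurable.mul (Continuous.aestronglyMeasurable (by fun_prop))
  have hψ_diff : ∫⁻ v, ‖ψ (v - c) - ψ v‖ₑ ≤
      ENNReal.ofReal ((2 : ℝ) ^ (-J) * ‖c‖ * ∫ u, ‖fderiv ℝ φ u‖) := by
    have ha : (0 : ℝ) < 2 ^ (-J) := by positivity
    have hscale : (2 : ℝ) ^ (-(n : ℤ) * J) = ((2 : ℝ) ^ (-J)) ^ n := by
      rw [← zpow_natCast, ← zpow_mul]
      ring_nf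
    set a : ℝ := 2 ^ (-J)
    have han : (0 : ℝ) < a ^ n := by positivity
    calc ∫⁻ v, ‖ψ (v - c) - ψ v‖ₑ
        = ∫⁻ v, ENNReal.ofReal (a ^ n) * ‖φ (a • v - a • c) - φ (a • v)‖ₑ := by
          simp only [hψ, hscale, ← mul_sub, enorm_mul, smul_sub,
            Real.enorm_of_nonneg han.le]
      _ = ∫⁻ w, ‖φ (w - a • c) - φ w‖ₑ := by
          rw [lintegral_const_mul' _ _ ENNReal.ofReal_ne_top,
            lintegral_comp_smul volume (fun w => ‖φ (w - a • c) - φ w‖ₑ) ha.ne',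
            ← mul_assoc, finrank_euclideanSpace_fin, abs_of_pos (inv_pos.2 han),
            ← ENNReal.ofReal_mul han.le, mul_inv_cancel₀ han.ne', ENNReal.ofReal_one, one_mul]
      _ ≤ ‖a • c‖ₑ * ∫⁻ w, ‖fderiv ℝ φ w‖ₑ := lintegral_enorm_sub_translate_le hφ _
      _ = _ := by
          rw [← ofReal_integral_norm_eq_lintegral_enorm hφ', ← ofReal_norm,
            ← ENNReal.ofReal_mul (norm_nonneg _), norm_smul, Real.norm_of_nonneg ha.le]
  simp only [eLpNorm_eq_lintegral_rpow_enorm_toReal two_ne_zero ENNReal.ofNat_ne_top,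
    ENNReal.toReal_ofNat]
  calc _ ≤ (∫⁻ u, (∫⁻ t, ‖x t‖ₑ * ‖ψ (u - t - c) - ψ (u - t)‖ₑ) ^ (2 : ℝ)) ^ (1 / 2 : ℝ) := by
        gcongr
        exact pointwise _
    _ ≤ ((∫⁻ v, ‖ψ (v - c) - ψ v‖ₑ) ^ (2 : ℝ) * ∫⁻ t, ‖x t‖ₑ ^ (2 : ℝ)) ^ (1 / 2 : ℝ) := by
        gcongr
        exact lintegral_convolution_sq_le (g := fun v => ‖ψ (v - c) - ψ v‖ₑ)
          hx.aestronglyMeasurable.enorm (Continuous.measurable (by fun_prop))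
    _ = (∫⁻ v, ‖ψ (v - c) - ψ v‖ₑ) * (∫⁻ t, ‖x t‖ₑ ^ (2 : ℝ)) ^ (1 / 2 : ℝ) := by
        rw [ENNReal.mul_rpow_of_nonneg _ _ (by norm_num), ← ENNReal.rpow_mul]
        norm_num
    _ ≤ _ := by gcongr
end

section
/- Let g : ℝⁿ → ℝⁿ be continuously differentiable with sup_{u∈ℝⁿ} ‖Dg(u)‖ ≤ δ for some δ < 1, where ‖Dg(u)‖ is the operator norm of the Jacobian. Then the map u ↦ u − g(u) is a bijective diffeomorphism of ℝⁿ, and for every x ∈ L²(ℝⁿ) the deformed signal g.x defined by (g.x)(u) = x(u − g(u)) satisfies ‖g.x‖_{L²}² ≤ (1 − δ)^{−n} ‖x‖_{L²}². -/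
open MeasureTheory

namespace LipschitzWith

theorem bijective_id_sub {E : Type*} [NormedAddCommGroup E] [CompleteSpace E] {g : E → E}
    {K : NNReal} (hg : LipschitzWith K g) (hK : K < 1) :
    Function.Bijective (fun u => u - g u) := by
  constructor
  · simpa [sub_eq_add_neg] using
      (AntilipschitzWith.id.add_lipschitzWith hg.neg (by simpa using hK)).injective
  · intro y
    have hc : ContractingWith K (fun u => y + g u) :=
      ⟨hK, by simpa using (LipschitzWith.const y).add hg⟩
    exact ⟨hc.fixedPoint _, sub_eq_of_eq_add hc.fixedPoint_isFixedPt.symm⟩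

end LipschitzWith

namespace AntilipschitzWith

variable {E : Type*} [NormedAddCommGroup E] [NormedSpace ℝ E] [FiniteDimensional ℝ E]
  [MeasurableSpace E] [BorelSpace E]

theorem addHaar_preimage_le {f : E → E} {K : NNReal} (hf : AntilipschitzWith K f)
    (μ : Measure E) [μ.IsAddHaarMeasure] (s : Set E) :
    μ (f ⁻¹' s) ≤ (K : ENNReal) ^ Module.finrank ℝ E * μ s := by
  rw [Measure.isAddLeftInvariant_eq_smul μ
    (Measure.hausdorffMeasure (Module.finrank ℝ E) : Measure E)]
  simp only [Measure.smul_apply, ENNReal.smul_def, smul_eq_mul]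
  rw [mul_left_comm]
  gcongr
  simpa using hf.hausdorffMeasure_preimage_le (Nat.cast_nonneg (Module.finrank ℝ E)) s

theorem map_addHaar_le {f : E → E} {K : NNReal} (hf : AntilipschitzWith K f)
    (hm : Measurable f) (μ : Measure E) [μ.IsAddHaarMeasure] :
    μ.map f ≤ (K : ENNReal) ^ Module.finrank ℝ E • μ := by
  refine Measure.le_iff.2 fun s hs => ?_
  rw [Measure.map_apply hm hs]
  exact hf.addHaar_preimage_le μ s

theorem eLpNorm_two_comp_sq_le {F : Type*} [NormedAddCommGroup F] {f : E → E} {K : NNReal}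
    (hf : AntilipschitzWith K f) (hm : Measurable f) {μ : Measure E} [μ.IsAddHaarMeasure]
    {x : E → F} (hx : AEStronglyMeasurable x μ) :
    eLpNorm (fun u => x (f u)) 2 μ ^ 2 ≤
      (K : ENNReal) ^ Module.finrank ℝ E * eLpNorm x 2 μ ^ 2 := by
  have hle := hf.map_addHaar_le hm μ
  have hac : μ.map f ≪ μ := Measure.absolutelyContinuous_of_le_smul hle
  calc
    eLpNorm (fun u => x (f u)) 2 μ ^ 2 = eLpNorm x 2 (μ.map f) ^ 2 := by
      rw [eLpNorm_map_measure (hx.mono_ac hac) hm.aemeasurable, Function.comp_def]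
    _ ≤ eLpNorm x 2 ((K : ENNReal) ^ Module.finrank ℝ E • μ) ^ 2 := by
      gcongr
    _ = (K : ENNReal) ^ Module.finrank ℝ E * eLpNorm x 2 μ ^ 2 := by
      rw [eLpNorm_smul_measure_of_ne_top ENNReal.ofNat_ne_top, smul_eq_mul, mul_pow,
        ← ENNReal.rpow_mul_natCast]
      simp

end AntilipschitzWith

/-- If `g : ℝⁿ → ℝⁿ` is `C¹` with `sup_u ‖Dg(u)‖ ≤ δ < 1`, then `u ↦ u − g(u)` is a
bijective (`C¹`) diffeomorphism of `ℝⁿ`, and the deformation operator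
`x ↦ g.x = x(· − g(·))` is bounded on `L²`: `‖g.x‖² ≤ (1 − δ)^{-n} ‖x‖²`. -/
theorem deformation_operator_bounded (n : ℕ)
    (g : EuclideanSpace ℝ (Fin n) → EuclideanSpace ℝ (Fin n))
    (hg : ContDiff ℝ 1 g) (δ : ℝ) (hδ : δ < 1)
    (hDg : ∀ u, ‖fderiv ℝ g u‖ ≤ δ) :
    (ContDiff ℝ 1 (fun u => u - g u) ∧ Function.Bijective (fun u => u - g u)) ∧
      ∀ x : EuclideanSpace ℝ (Fin n) → ℝ,
        MemLp x 2 (volume : Measure (EuclideanSpace ℝ (Fin n))) →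
        eLpNorm (fun u => x (u - g u)) 2
            (volume : Measure (EuclideanSpace ℝ (Fin n))) ^ 2 ≤
          ENNReal.ofReal ((1 - δ) ^ (-(n : ℤ))) *
            eLpNorm x 2 (volume : Measure (EuclideanSpace ℝ (Fin n))) ^ 2 := by
  have hδ0 : 0 ≤ δ := (norm_nonneg _).trans (hDg 0)
  lift δ to NNReal using hδ0
  have hδ1 : δ < 1 := by exact_mod_cast hδ
  have hlip : LipschitzWith δ g :=
    lipschitzWith_of_nnnorm_fderiv_le (hg.differentiable one_ne_zero) hDg
  have hf : ContDiff ℝ 1 (fun u => u - g u) := contDiff_id.sub hg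
  have hanti : AntilipschitzWith (1 - δ)⁻¹ (fun u => u - g u) := by
    simpa [sub_eq_add_neg] using
      AntilipschitzWith.id.add_lipschitzWith hlip.neg (by simpa using hδ1)
  refine ⟨⟨hf, hlip.bijective_id_sub hδ1⟩, fun x hx => ?_⟩
  convert hanti.eLpNorm_two_comp_sq_le hf.continuous.measurable hx.1 using 2
  rw [finrank_euclideanSpace_fin, ← ENNReal.coe_pow, ← ENNReal.ofReal_coe_nnreal]
  simp [NNReal.coe_sub hδ1.le]
end

section
/- Let φ : ℝⁿ → ℝ be a compactly supported C¹ function, and for J ∈ ℤ let φ_J(u) = 2^{−nJ}φ(2^{−J}u). Then there exists a constant C > 0, depending only on φ and n, such that for every C¹ map g : ℝⁿ → ℝⁿ with sup_{u} ‖Dg(u)‖ ≤ 1/2 and every x ∈ L²(ℝⁿ), ‖(g.x) ∗ φ_J − x ∗ φ_J‖_{L²} ≤ C (2^{−J} sup_{u∈ℝⁿ} |g(u)| + sup_{u∈ℝⁿ} ‖Dg(u)‖) ‖x‖_{L²}, where (g.x)(u) = x(u − g(u)). -/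
open MeasureTheory ENNReal

open Module

section Deformation

variable {E : Type*} [NormedAddCommGroup E]

/-- Cauchy–Schwarz for the weight `w`. -/
theorem sq_lintegral_mul_le {α : Type*} [MeasurableSpace α] {μ : Measure α} {f w : α → ℝ≥0∞}
    (hf : AEMeasurable f μ) (hw : AEMeasurable w μ) :
    (∫⁻ a, f a * w a ∂μ) ^ 2 ≤ (∫⁻ a, w a ∂μ) * ∫⁻ a, f a ^ 2 * w a ∂μ := by
  have half (c : ℝ≥0∞) : c ^ (1 / 2 : ℝ) * c ^ (1 / 2 : ℝ) = c := by
    rw [← ENNReal.rpow_add_of_nonneg _ _ (by norm_num) (by norm_num)]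
    norm_num
  have h := ENNReal.lintegral_mul_le_Lp_mul_Lq μ Real.HolderConjugate.two_two
    (hf.mul (hw.pow_const (1 / 2 : ℝ))) (hw.pow_const (1 / 2 : ℝ))
  simp only [Pi.mul_apply, mul_assoc, half, ENNReal.rpow_two, mul_pow, sq (_ ^ (1 / 2 : ℝ))] at h
  calc (∫⁻ a, f a * w a ∂μ) ^ 2
      ≤ ((∫⁻ a, f a ^ 2 * w a ∂μ) ^ (1 / 2 : ℝ) * (∫⁻ a, w a ∂μ) ^ (1 / 2 : ℝ)) ^ 2 := by
        gcongr
    _ = (∫⁻ a, w a ∂μ) * ∫⁻ a, f a ^ 2 * w a ∂μ := by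
        rw [mul_pow, sq (_ ^ (1 / 2 : ℝ)), sq (_ ^ (1 / 2 : ℝ)), half, half, mul_comm]

/-- Young's convolution inequality `L² * L¹ → L²` for nonnegative functions. -/
theorem lintegral_sq_lintegral_mul_sub_le [MeasurableSpace E] [BorelSpace E]
    [SecondCountableTopology E] {μ : Measure E} [SFinite μ] [μ.IsAddHaarMeasure]
    [μ.IsNegInvariant] {f w : E → ℝ≥0∞} (hf : AEMeasurable f μ) (hw : Measurable w) :
    ∫⁻ u, (∫⁻ v, f v * w (u - v) ∂μ) ^ 2 ∂μ ≤ (∫⁻ u, w u ∂μ) ^ 2 * ∫⁻ v, f v ^ 2 ∂μ := by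
  calc ∫⁻ u, (∫⁻ v, f v * w (u - v) ∂μ) ^ 2 ∂μ
      ≤ ∫⁻ u, (∫⁻ v, w v ∂μ) * ∫⁻ v, f v ^ 2 * w (u - v) ∂μ ∂μ := by
        gcongr with u
        refine (sq_lintegral_mul_le hf (by fun_prop)).trans_eq ?_
        rw [lintegral_sub_left_eq_self w u]
    _ = (∫⁻ v, w v ∂μ) * ∫⁻ v, ∫⁻ u, f v ^ 2 * w (u - v) ∂μ ∂μ := by
        have hm : AEMeasurable (Function.uncurry fun u v => f v ^ 2 * w (u - v)) (μ.prod μ) := by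
          refine AEMeasurable.mul ?_ (hw.comp (measurable_fst.sub measurable_snd)).aemeasurable
          exact (hf.pow_const 2).comp_quasiMeasurePreserving
            Measure.quasiMeasurePreserving_snd
        rw [lintegral_const_mul'' _ (by exact hm.lintegral_prod_right'), lintegral_lintegral_swap hm]
    _ = (∫⁻ u, w u ∂μ) ^ 2 * ∫⁻ v, f v ^ 2 ∂μ := by
        have (v : E) : ∫⁻ u, f v ^ 2 * w (u - v) ∂μ = f v ^ 2 * ∫⁻ u, w u ∂μ := by
          rw [lintegral_const_mul _ (by fun_prop), lintegral_sub_right_eq_self w v]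
        simp only [this]
        rw [lintegral_mul_const'' _ (hf.pow_const 2)]
        ring

theorem sub_id_injective_of_lipschitz {g : E → E} (hg : LipschitzWith (1 / 2) g) :
    Function.Injective fun u => u - g u := by
  intro a b hab
  have h := hg.dist_le_mul a b
  have hab' : g a - g b = a - b := by
    have : a - g a = b - g b := hab
    rw [sub_eq_sub_iff_sub_eq_sub] at this
    exact this.symm
  rw [dist_eq_norm, dist_eq_norm, hab'] at h
  have : ‖a - b‖ ≤ 0 := by push_cast at h; linarith
  exact sub_eq_zero.1 (norm_le_zero_iff.1 this)

theorem sub_id_surjective_of_lipschitz [CompleteSpace E] {g : E → E}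
    (hg : LipschitzWith (1 / 2) g) : Function.Surjective fun u => u - g u := by
  intro y
  have hc : ContractingWith (1 / 2) fun u => y + g u :=
    ⟨by rw [← NNReal.coe_lt_coe]; norm_num, LipschitzWith.of_dist_le_mul fun a b => by
      simpa using hg.dist_le_mul a b⟩
  obtain ⟨u, hu, -⟩ := hc.exists_fixedPoint 0 (edist_ne_top _ _)
  refine ⟨u, ?_⟩
  have : y + g u = u := hu
  exact sub_eq_of_eq_add this.symm

variable [NormedSpace ℝ E]

theorem lipschitzWith_half_of_norm_fderiv_le {g : E → E} (hg : ContDiff ℝ 1 g)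
    (hg' : ∀ u, ‖fderiv ℝ g u‖ ≤ 1 / 2) : LipschitzWith (1 / 2) g :=
  lipschitzWith_of_nnnorm_fderiv_le (𝕜 := ℝ) (hg.differentiable (by simp)) fun u => by
    rw [← NNReal.coe_le_coe]
    simpa using hg' u

theorem hasFDerivAt_sub_id {g : E → E} (hg : ContDiff ℝ 1 g) (u : E) :
    HasFDerivAt (fun u => u - g u) (ContinuousLinearMap.id ℝ E - fderiv ℝ g u) u :=
  (hasFDerivAt_id u).sub (hg.differentiable (by simp) u).hasFDerivAt

variable [FiniteDimensional ℝ E]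

/-- The Jacobian of a perturbation of the identity. -/
theorem abs_det_id_sub_bounds (T : E →L[ℝ] E) (hT : ‖T‖ < 1) :
    (1 - ‖T‖) ^ finrank ℝ E ≤ |(ContinuousLinearMap.id ℝ E - T).det| ∧
      |(ContinuousLinearMap.id ℝ E - T).det| ≤ (1 + ‖T‖) ^ finrank ℝ E := by
  let _ : MeasurableSpace E := borel E
  have : BorelSpace E := ⟨rfl⟩
  set A := ContinuousLinearMap.id ℝ E - T
  set μ : Measure E := Measure.addHaar
  have hA (v : E) : A v = v - T v := rfl
  have hpos : μ (Metric.closedBall 0 1) ≠ 0 :=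
    (Metric.measure_closedBall_pos μ 0 one_pos).ne'
  have hfin : μ (Metric.closedBall 0 1) ≠ ∞ := measure_closedBall_lt_top.ne
  have himg := Measure.addHaar_image_continuousLinearMap μ A (Metric.closedBall 0 1)
  have hlow : Metric.closedBall (0 : E) (1 - ‖T‖) ⊆ A '' Metric.closedBall 0 1 := by
    have hbelow (v : E) : (1 - ‖T‖) * ‖v‖ ≤ ‖A v‖ := by
      have := norm_sub_norm_le v (T v)
      have := T.le_opNorm v
      rw [hA]
      linarith
    have hinj : Function.Injective (A : E →ₗ[ℝ] E) := by
      rw [← LinearMap.ker_eq_bot, LinearMap.ker_eq_bot']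
      intro v hv
      have h := hbelow v
      rw [show A v = 0 from hv, norm_zero] at h
      exact norm_le_zero_iff.1 (nonpos_of_mul_nonpos_right h (sub_pos.2 hT))
    intro y hy
    obtain ⟨v, rfl⟩ := LinearMap.injective_iff_surjective.1 hinj y
    refine ⟨v, ?_, rfl⟩
    rw [mem_closedBall_zero_iff] at hy ⊢
    have h := (hbelow v).trans hy
    exact (mul_le_iff_le_one_right (sub_pos.2 hT)).1 h
  have hup : A '' Metric.closedBall 0 1 ⊆ Metric.closedBall (0 : E) (1 + ‖T‖) := by
    rintro _ ⟨v, hv, rfl⟩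
    rw [mem_closedBall_zero_iff] at hv ⊢
    have := norm_sub_le v (T v)
    have := T.le_opNorm v
    have := mul_le_of_le_one_right (norm_nonneg T) hv
    rw [hA]
    linarith
  constructor
  · have h := measure_mono (μ := μ) hlow
    rw [himg, Measure.addHaar_closedBall' μ _ (sub_nonneg.2 hT.le),
      ENNReal.mul_le_mul_iff_left hpos hfin] at h
    exact (ENNReal.ofReal_le_ofReal_iff (abs_nonneg _)).1 h
  · have h := measure_mono (μ := μ) hup
    rw [himg, Measure.addHaar_closedBall' μ (r := 1 + ‖T‖) _ (by positivity),
      ENNReal.mul_le_mul_iff_left hpos hfin] at h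
    exact (ENNReal.ofReal_le_ofReal_iff (by positivity)).1 h

theorem one_add_pow_le {t : ℝ} (h0 : 0 ≤ t) (h1 : t ≤ 1) (d : ℕ) :
    (1 + t) ^ d ≤ 1 + (2 ^ d - 1) * t := by
  induction d with
  | zero => simp
  | succ d ih =>
    have h2 : (1 : ℝ) ≤ 2 ^ d := one_le_pow₀ (by norm_num)
    calc (1 + t) ^ (d + 1) = (1 + t) ^ d * (1 + t) := pow_succ _ _
      _ ≤ (1 + (2 ^ d - 1) * t) * (1 + t) := by gcongr
      _ ≤ 1 + (2 ^ (d + 1) - 1) * t := by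
        rw [pow_succ]
        nlinarith [mul_nonneg (mul_nonneg (sub_nonneg.2 h2) h0) (sub_nonneg.2 h1)]

theorem abs_one_sub_abs_det_le (T : E →L[ℝ] E) (hT : ‖T‖ ≤ 1 / 2) :
    |1 - (|(ContinuousLinearMap.id ℝ E - T).det|)| ≤ 2 ^ finrank ℝ E * ‖T‖ := by
  obtain ⟨h1, h2⟩ := abs_det_id_sub_bounds T (by linarith)
  have h3 := one_add_pow_le (norm_nonneg T) (by linarith) (finrank ℝ E)
  have h4 := one_add_mul_le_pow (a := -‖T‖) (by linarith) (finrank ℝ E)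
  have h5 : (finrank ℝ E : ℝ) ≤ 2 ^ finrank ℝ E := by exact_mod_cast Nat.lt_two_pow_self.le
  have h6 := mul_le_mul_of_nonneg_right h5 (norm_nonneg T)
  rw [← sub_eq_add_neg] at h4
  rw [abs_le]
  constructor <;> linarith [norm_nonneg T]

theorem one_le_two_pow_mul_abs_det (T : E →L[ℝ] E) (hT : ‖T‖ ≤ 1 / 2) :
    1 ≤ 2 ^ finrank ℝ E * |(ContinuousLinearMap.id ℝ E - T).det| := by
  obtain ⟨h1, -⟩ := abs_det_id_sub_bounds T (by linarith)
  have h2 : (1 / 2 : ℝ) ^ finrank ℝ E ≤ (1 - ‖T‖) ^ finrank ℝ E := by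
    gcongr
    linarith
  calc (1 : ℝ) = 2 ^ finrank ℝ E * (1 / 2) ^ finrank ℝ E := by
        rw [← mul_pow]; norm_num
    _ ≤ _ := by gcongr; exact h2.trans h1

/-- Deformation of a kernel dominated, together with its increments, by `w`. -/
theorem abs_kernel_sub_det_mul_kernel_le {g : E → E} (hg' : ∀ u, ‖fderiv ℝ g u‖ ≤ 1 / 2)
    {k w : E → ℝ} {L K : ℝ} (hw : ∀ a, 0 ≤ w a) (hK0 : 0 ≤ K)
    (hL : ∀ a b, |k a - k b| ≤ L * ‖a - b‖ * (w a + w b)) (hK : ∀ a, |k a| ≤ K * w a) (u v : E) :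
    |k (u - v) - |(ContinuousLinearMap.id ℝ E - fderiv ℝ g v).det| * k (u - (v - g v))| ≤
      (L * ‖g v‖ + 2 ^ finrank ℝ E * K * ‖fderiv ℝ g v‖) * (w (u - v) + w (u - (v - g v))) := by
  set D := |(ContinuousLinearMap.id ℝ E - fderiv ℝ g v).det|
  have h1 := hL (u - v) (u - (v - g v))
  rw [show u - v - (u - (v - g v)) = -g v by abel, norm_neg] at h1
  have h2 : |(1 - D) * k (u - (v - g v))| ≤
      2 ^ finrank ℝ E * ‖fderiv ℝ g v‖ * (K * (w (u - v) + w (u - (v - g v)))) := by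
    rw [abs_mul]
    gcongr
    · exact abs_one_sub_abs_det_le _ (hg' v)
    · exact (hK _).trans (by gcongr; linarith [hw (u - v)])
  calc |k (u - v) - D * k (u - (v - g v))|
      = |(k (u - v) - k (u - (v - g v))) + (1 - D) * k (u - (v - g v))| := by ring_nf
    _ ≤ _ := (abs_add_le _ _).trans (add_le_add h1 h2)
    _ = _ := by ring

variable [MeasurableSpace E] [BorelSpace E] {μ : Measure E} [μ.IsAddHaarMeasure]

theorem lintegral_abs_det_mul_comp_sub_id {g : E → E} (hg : ContDiff ℝ 1 g)
    (hg' : ∀ u, ‖fderiv ℝ g u‖ ≤ 1 / 2) (h : E → ℝ≥0∞) :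
    ∫⁻ v, ENNReal.ofReal |(ContinuousLinearMap.id ℝ E - fderiv ℝ g v).det| * h (v - g v) ∂μ =
      ∫⁻ v, h v ∂μ := by
  have hlip := lipschitzWith_half_of_norm_fderiv_le hg hg'
  have key := lintegral_image_eq_lintegral_abs_det_fderiv_mul μ MeasurableSet.univ
    (fun u _ => (hasFDerivAt_sub_id hg u).hasFDerivWithinAt)
    (sub_id_injective_of_lipschitz hlip).injOn h
  rw [Set.image_univ, (sub_id_surjective_of_lipschitz hlip).range_eq] at key
  simpa using key.symm

theorem integral_abs_det_mul_comp_sub_id {g : E → E} (hg : ContDiff ℝ 1 g)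
    (hg' : ∀ u, ‖fderiv ℝ g u‖ ≤ 1 / 2) (h : E → ℝ) :
    ∫ v, |(ContinuousLinearMap.id ℝ E - fderiv ℝ g v).det| * h (v - g v) ∂μ =
      ∫ v, h v ∂μ := by
  have hlip := lipschitzWith_half_of_norm_fderiv_le hg hg'
  have key := integral_image_eq_integral_abs_det_fderiv_smul μ MeasurableSet.univ
    (fun u _ => (hasFDerivAt_sub_id hg u).hasFDerivWithinAt)
    (sub_id_injective_of_lipschitz hlip).injOn h
  rw [Set.image_univ, (sub_id_surjective_of_lipschitz hlip).range_eq] at key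
  simpa using key.symm

theorem Integrable.abs_det_mul_comp_sub_id {g : E → E} (hg : ContDiff ℝ 1 g)
    (hg' : ∀ u, ‖fderiv ℝ g u‖ ≤ 1 / 2) {h : E → ℝ} (hh : Integrable h μ) :
    Integrable (fun v =>
      |(ContinuousLinearMap.id ℝ E - fderiv ℝ g v).det| * h (v - g v)) μ := by
  have hlip := lipschitzWith_half_of_norm_fderiv_le hg hg'
  have key := integrableOn_image_iff_integrableOn_abs_det_fderiv_smul μ MeasurableSet.univ
    (fun u _ => (hasFDerivAt_sub_id hg u).hasFDerivWithinAt)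
    (sub_id_injective_of_lipschitz hlip).injOn h
  rw [Set.image_univ, (sub_id_surjective_of_lipschitz hlip).range_eq] at key
  simpa using key.1 (by simpa using hh)

theorem lintegral_comp_sub_id_le {g : E → E} (hg : ContDiff ℝ 1 g)
    (hg' : ∀ u, ‖fderiv ℝ g u‖ ≤ 1 / 2) (h : E → ℝ≥0∞) :
    ∫⁻ v, h (v - g v) ∂μ ≤ 2 ^ finrank ℝ E * ∫⁻ v, h v ∂μ := by
  rw [← lintegral_abs_det_mul_comp_sub_id hg hg' h, ← lintegral_const_mul' _ _ (by finiteness)]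
  gcongr with v
  rw [← mul_assoc]
  refine le_mul_of_one_le_left zero_le ?_
  have := ENNReal.ofReal_le_ofReal (one_le_two_pow_mul_abs_det _ (hg' v))
  rwa [ENNReal.ofReal_one, ENNReal.ofReal_mul (by positivity), ENNReal.ofReal_pow (by norm_num),
    ENNReal.ofReal_ofNat] at this

theorem quasiMeasurePreserving_sub_id {g : E → E} (hg : ContDiff ℝ 1 g)
    (hg' : ∀ u, ‖fderiv ℝ g u‖ ≤ 1 / 2) :
    Measure.QuasiMeasurePreserving (fun v => v - g v) μ μ := by
  have hm : Measurable fun v => v - g v := (continuous_id.sub hg.continuous).measurable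
  refine ⟨hm, Measure.AbsolutelyContinuous.mk fun s hs h0 => ?_⟩
  rw [Measure.map_apply hm hs, ← lintegral_indicator_one (hm hs)]
  refine nonpos_iff_eq_zero.1 ((lintegral_comp_sub_id_le hg hg' (s.indicator 1)).trans_eq ?_)
  rw [lintegral_indicator_one hs, h0, mul_zero]

theorem eLpNorm_two_sq {α F : Type*} [MeasurableSpace α] [NormedAddCommGroup F] {ν : Measure α}
    (f : α → F) : eLpNorm f 2 ν ^ 2 = ∫⁻ a, ‖f a‖ₑ ^ 2 ∂ν := by
  rw [eLpNorm_eq_lintegral_rpow_enorm_toReal (by norm_num) (by norm_num), ← ENNReal.rpow_two,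
    ← ENNReal.rpow_mul]
  simp

theorem MemLp.comp_sub_id {g : E → E} (hg : ContDiff ℝ 1 g)
    (hg' : ∀ u, ‖fderiv ℝ g u‖ ≤ 1 / 2) {x : E → ℝ} (hx : MemLp x 2 μ) :
    MemLp (fun v => x (v - g v)) 2 μ := by
  refine ⟨hx.1.comp_quasiMeasurePreserving (quasiMeasurePreserving_sub_id hg hg'), ?_⟩
  suffices h : eLpNorm (fun v => x (v - g v)) 2 μ ^ 2 < ∞ from
    (ENNReal.pow_lt_top_iff.1 h).resolve_right two_ne_zero
  rw [eLpNorm_two_sq]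
  refine (lintegral_comp_sub_id_le hg hg' fun v => ‖x v‖ₑ ^ 2).trans_lt ?_
  rw [← eLpNorm_two_sq]
  have := hx.2
  finiteness

theorem enorm_convolution_comp_sub_id_sub_le {g : E → E} (hg : ContDiff ℝ 1 g)
    (hg' : ∀ u, ‖fderiv ℝ g u‖ ≤ 1 / 2) {x : E → ℝ} (hx : MemLp x 2 μ)
    {k w : E → ℝ} {L K : ℝ} (hk : Continuous k) (hkc : HasCompactSupport k)
    (hwm : Measurable w) (hw : ∀ a, 0 ≤ w a) (hL0 : 0 ≤ L) (hK0 : 0 ≤ K)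
    (hL : ∀ a b, |k a - k b| ≤ L * ‖a - b‖ * (w a + w b)) (hK : ∀ a, |k a| ≤ K * w a) (u : E) :
    ‖convolution (fun v => x (v - g v)) k (ContinuousLinearMap.mul ℝ ℝ) μ u -
        convolution x k (ContinuousLinearMap.mul ℝ ℝ) μ u‖ₑ ≤
      ∫⁻ v, ((ENNReal.ofReal L * (⨆ u, ‖g u‖ₑ) +
          ENNReal.ofReal (2 ^ finrank ℝ E * K) * ⨆ u, ‖fderiv ℝ g u‖ₑ) *
        (‖x (v - g v)‖ₑ + 2 ^ finrank ℝ E * ‖x v‖ₑ)) * ENNReal.ofReal (w (u - v)) ∂μ := by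
  set S := ENNReal.ofReal L * (⨆ u, ‖g u‖ₑ) +
    ENNReal.ofReal (2 ^ finrank ℝ E * K) * ⨆ u, ‖fderiv ℝ g u‖ₑ with hS
  have hxF := MemLp.comp_sub_id hg hg' hx
  have hqmp := quasiMeasurePreserving_sub_id (μ := μ) hg hg'
  have hI1 : Integrable (fun v => x (v - g v) * k (u - v)) μ :=
    hkc.convolutionExists_right (ContinuousLinearMap.mul ℝ ℝ)
      (hxF.locallyIntegrable (by norm_num)) hk u
  have hI2 : Integrable (fun v => x v * k (u - v)) μ :=
    hkc.convolutionExists_right (ContinuousLinearMap.mul ℝ ℝ)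
      (hx.locallyIntegrable (by norm_num)) hk u
  have hpt (v : E) : ‖x (v - g v) * k (u - v) -
      |(ContinuousLinearMap.id ℝ E - fderiv ℝ g v).det| *
        (x (v - g v) * k (u - (v - g v)))‖ₑ ≤
      S * (‖x (v - g v)‖ₑ * ENNReal.ofReal (w (u - v))) +
        S * (‖x (v - g v)‖ₑ * ENNReal.ofReal (w (u - (v - g v)))) := by
    have h := ENNReal.ofReal_le_ofReal
      (abs_kernel_sub_det_mul_kernel_le (g := g) hg' hw hK0 hL hK u v)
    rw [ENNReal.ofReal_mul (by positivity), ENNReal.ofReal_add (by positivity) (by positivity),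
      ENNReal.ofReal_add (hw _) (hw _), ENNReal.ofReal_mul hL0, ENNReal.ofReal_mul (by positivity),
      ofReal_norm, ofReal_norm, ← Real.norm_eq_abs, ofReal_norm] at h
    have hle : ENNReal.ofReal L * ‖g v‖ₑ +
        ENNReal.ofReal (2 ^ finrank ℝ E * K) * ‖fderiv ℝ g v‖ₑ ≤ S := by
      rw [hS]
      gcongr
      · exact le_iSup (fun u => ‖g u‖ₑ) v
      · exact le_iSup (fun u => ‖fderiv ℝ g u‖ₑ) v
    rw [mul_left_comm, ← mul_sub, enorm_mul]
    calc _ ≤ ‖x (v - g v)‖ₑ * (S * (ENNReal.ofReal (w (u - v)) +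
          ENNReal.ofReal (w (u - (v - g v))))) := by
          gcongr
          exact h.trans (by gcongr)
      _ = _ := by ring
  have hm1 : AEMeasurable (fun v => ‖x (v - g v)‖ₑ * ENNReal.ofReal (w (u - v))) μ :=
    hxF.1.enorm.mul (by fun_prop)
  have hm2 : AEMeasurable (fun v => ‖x v‖ₑ * ENNReal.ofReal (w (u - v))) μ :=
    hx.1.enorm.mul (by fun_prop)
  have hm3 : AEMeasurable (fun v => ‖x (v - g v)‖ₑ * ENNReal.ofReal (w (u - (v - g v)))) μ :=
    hm2.comp_quasiMeasurePreserving hqmp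
  simp only [convolution_def, ContinuousLinearMap.mul_apply']
  rw [← integral_abs_det_mul_comp_sub_id hg hg' fun v => x v * k (u - v),
    ← integral_sub hI1 (Integrable.abs_det_mul_comp_sub_id hg hg' hI2)]
  calc _ ≤ ∫⁻ v, _ ∂μ := (enorm_integral_le_lintegral_enorm _).trans (lintegral_mono hpt)
    _ = S * (∫⁻ v, ‖x (v - g v)‖ₑ * ENNReal.ofReal (w (u - v)) ∂μ) +
        S * (∫⁻ v, ‖x (v - g v)‖ₑ * ENNReal.ofReal (w (u - (v - g v))) ∂μ) := by
      rw [lintegral_add_left' (hm1.const_mul _), lintegral_const_mul'' _ hm1,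
        lintegral_const_mul'' _ hm3]
    _ ≤ S * (∫⁻ v, ‖x (v - g v)‖ₑ * ENNReal.ofReal (w (u - v)) ∂μ) +
        S * (2 ^ finrank ℝ E * ∫⁻ v, ‖x v‖ₑ * ENNReal.ofReal (w (u - v)) ∂μ) := by
      gcongr
      exact lintegral_comp_sub_id_le hg hg' fun v => ‖x v‖ₑ * ENNReal.ofReal (w (u - v))
    _ = _ := by
      rw [← lintegral_const_mul'' _ hm1, ← lintegral_const_mul'' _ hm2,
        ← lintegral_const_mul'' _ (hm2.const_mul _),
        ← lintegral_add_left' (hm1.const_mul _)]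
      congr with v
      ring

/-- Deformation stability for the convolution with a kernel dominated, together with its
increments, by an integrable weight. -/
theorem eLpNorm_convolution_comp_sub_id_sub_le [μ.IsNegInvariant] {g : E → E}
    (hg : ContDiff ℝ 1 g)
    (hg' : ∀ u, ‖fderiv ℝ g u‖ ≤ 1 / 2) {x : E → ℝ} (hx : MemLp x 2 μ)
    {k w : E → ℝ} {L K : ℝ} (hk : Continuous k) (hkc : HasCompactSupport k)
    (hwm : Measurable w) (hw : ∀ a, 0 ≤ w a) (hL0 : 0 ≤ L) (hK0 : 0 ≤ K)
    (hL : ∀ a b, |k a - k b| ≤ L * ‖a - b‖ * (w a + w b)) (hK : ∀ a, |k a| ≤ K * w a) :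
    eLpNorm (fun u => convolution (fun v => x (v - g v)) k (ContinuousLinearMap.mul ℝ ℝ) μ u -
        convolution x k (ContinuousLinearMap.mul ℝ ℝ) μ u) 2 μ ≤
      (∫⁻ u, ENNReal.ofReal (w u) ∂μ) * (ENNReal.ofReal L * (⨆ u, ‖g u‖ₑ) +
          ENNReal.ofReal (2 ^ finrank ℝ E * K) * ⨆ u, ‖fderiv ℝ g u‖ₑ) *
        (2 * 2 ^ finrank ℝ E) * eLpNorm x 2 μ := by
  set S := ENNReal.ofReal L * (⨆ u, ‖g u‖ₑ) +
    ENNReal.ofReal (2 ^ finrank ℝ E * K) * ⨆ u, ‖fderiv ℝ g u‖ₑ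
  set W := ∫⁻ u, ENNReal.ofReal (w u) ∂μ
  set c : ℝ≥0∞ := 2 ^ finrank ℝ E
  have hc1 : 1 ≤ c := one_le_pow₀ (by norm_num)
  have hxF := MemLp.comp_sub_id hg hg' hx
  have hsum : AEMeasurable (fun v => ‖x (v - g v)‖ₑ + c * ‖x v‖ₑ) μ :=
    hxF.1.enorm.add (hx.1.enorm.const_mul _)
  have hsq (a b : ℝ≥0∞) : (a + b) ^ 2 ≤ 2 * a ^ 2 + 2 * b ^ 2 := by
    have := ENNReal.rpow_add_le_mul_rpow_add_rpow a b (p := 2) (by norm_num)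
    norm_num [mul_add] at this
    exact this
  rw [← (ENNReal.pow_right_strictMono two_ne_zero).le_iff_le, eLpNorm_two_sq]
  calc _ ≤ ∫⁻ u, (∫⁻ v, S * (‖x (v - g v)‖ₑ + c * ‖x v‖ₑ) *
          ENNReal.ofReal (w (u - v)) ∂μ) ^ 2 ∂μ := by
        gcongr with u
        exact enorm_convolution_comp_sub_id_sub_le hg hg' hx hk hkc hwm hw hL0 hK0 hL hK u
    _ ≤ W ^ 2 * ∫⁻ v, (S * (‖x (v - g v)‖ₑ + c * ‖x v‖ₑ)) ^ 2 ∂μ :=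
        lintegral_sq_lintegral_mul_sub_le (hsum.const_mul S) hwm.ennreal_ofReal
    _ = W ^ 2 * (S ^ 2 * ∫⁻ v, (‖x (v - g v)‖ₑ + c * ‖x v‖ₑ) ^ 2 ∂μ) := by
        simp only [mul_pow]
        rw [lintegral_const_mul'' _ (hsum.pow_const 2)]
    _ ≤ W ^ 2 * (S ^ 2 * ∫⁻ v, 2 * ‖x (v - g v)‖ₑ ^ 2 + 2 * (c * ‖x v‖ₑ) ^ 2 ∂μ) := by
        gcongr with v
        exact hsq _ _
    _ = W ^ 2 * (S ^ 2 * (2 * (∫⁻ v, ‖x (v - g v)‖ₑ ^ 2 ∂μ) +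
          2 * (c ^ 2 * ∫⁻ v, ‖x v‖ₑ ^ 2 ∂μ))) := by
        simp only [mul_pow]
        rw [lintegral_add_left' ((hxF.1.enorm.pow_const 2).const_mul 2),
          lintegral_const_mul'' _ (hxF.1.enorm.pow_const 2),
          lintegral_const_mul'' _ ((hx.1.enorm.pow_const 2).const_mul _),
          lintegral_const_mul'' _ (hx.1.enorm.pow_const 2)]
    _ ≤ W ^ 2 * (S ^ 2 * (2 * (c ^ 2 * ∫⁻ v, ‖x v‖ₑ ^ 2 ∂μ) +
          2 * (c ^ 2 * ∫⁻ v, ‖x v‖ₑ ^ 2 ∂μ))) := by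
        gcongr
        refine (lintegral_comp_sub_id_le hg hg' fun v => ‖x v‖ₑ ^ 2).trans ?_
        exact mul_le_mul' (le_self_pow₀ hc1 two_ne_zero) le_rfl
    _ = _ := by
        rw [← eLpNorm_two_sq]
        ring

end Deformation

section Dilation

variable {E : Type*} [NormedAddCommGroup E]

/-- A bound on the increments of a compactly supported Lipschitz function which is localized near
its support. -/
theorem abs_sub_le_of_lipschitzWith_of_tsupport_subset {φ : E → ℝ} {L : NNReal} {B : Set E}
    (hL : LipschitzWith L φ) (hB : tsupport φ ⊆ B) (a b : E) :
    |φ a - φ b| ≤ L * ‖a - b‖ * (B.indicator 1 a + B.indicator 1 b) := by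
  have h := hL.dist_le_mul a b
  rw [Real.dist_eq, dist_eq_norm] at h
  have h0 : 0 ≤ (L : ℝ) * ‖a - b‖ := by positivity
  by_cases ha : a ∈ B
  · by_cases hb : b ∈ B <;> simp [ha, hb] <;> linarith
  · by_cases hb : b ∈ B
    · simpa [ha, hb] using h
    · simp [ha, hb, image_eq_zero_of_notMem_tsupport fun h => ha (hB h),
        image_eq_zero_of_notMem_tsupport fun h => hb (hB h)]

theorem abs_le_mul_indicator_of_tsupport_subset {φ : E → ℝ} {K : ℝ} {B : Set E}
    (hK : ∀ a, ‖φ a‖ ≤ K) (hB : tsupport φ ⊆ B) (a : E) :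
    |φ a| ≤ K * B.indicator 1 a := by
  by_cases ha : a ∈ B
  · simpa [ha] using hK a
  · simp [ha, image_eq_zero_of_notMem_tsupport fun h => ha (hB h)]

theorem lintegral_dilation_indicator [NormedSpace ℝ E] [FiniteDimensional ℝ E] [MeasurableSpace E]
    [BorelSpace E] (μ : Measure E) [μ.IsAddHaarMeasure] {s : ℝ} (hs : 0 < s) {B : Set E}
    (hB : MeasurableSet B) :
    ∫⁻ u, ENNReal.ofReal (s ^ finrank ℝ E * B.indicator 1 (s • u)) ∂μ = μ B := by
  have h (u : E) : ENNReal.ofReal (s ^ finrank ℝ E * B.indicator 1 (s • u)) =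
      ENNReal.ofReal (s ^ finrank ℝ E) * ((s • ·) ⁻¹' B).indicator 1 u := by
    by_cases hu : s • u ∈ B <;> simp [hu]
  have hB' : MeasurableSet ((s • · : E → E) ⁻¹' B) := hB.preimage (measurable_const_smul s)
  simp only [h]
  rw [lintegral_const_mul' _ _ ENNReal.ofReal_ne_top, lintegral_indicator_one hB',
    Measure.addHaar_preimage_smul μ hs.ne', ← mul_assoc, ← ENNReal.ofReal_mul (by positivity),
    abs_of_pos (by positivity), mul_inv_cancel₀ (by positivity), ENNReal.ofReal_one, one_mul]

end Dilation

/-- Deformation stability of averaging (Theorem 2 of the paper, averaging channel):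
for a compactly supported `C¹` kernel `φ` with dilations `φ_J(u) = 2^{-nJ}φ(2^{-J}u)`,
there is `C > 0` depending only on `φ` and `n` such that for every `C¹` deformation
field `g` with `sup ‖Dg‖ ≤ 1/2` and every `x ∈ L²(ℝⁿ)`,
`‖(g.x) ∗ φ_J − x ∗ φ_J‖ ≤ C (2^{-J} sup|g| + sup‖Dg‖) ‖x‖`,
where `(g.x)(u) = x(u − g(u))`. -/
theorem averaging_deformation_stability (n : ℕ)
    (φ : EuclideanSpace ℝ (Fin n) → ℝ) (hφ : ContDiff ℝ 1 φ)
    (hφc : HasCompactSupport φ) :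
    ∃ C : ℝ, 0 < C ∧
      ∀ (J : ℤ) (g : EuclideanSpace ℝ (Fin n) → EuclideanSpace ℝ (Fin n)),
        ContDiff ℝ 1 g → (∀ u, ‖fderiv ℝ g u‖ ≤ 1 / 2) →
        ∀ x : EuclideanSpace ℝ (Fin n) → ℝ,
          MemLp x 2 (volume : Measure (EuclideanSpace ℝ (Fin n))) →
          eLpNorm (fun u =>
              convolution (fun v => x (v - g v))
                (fun v => (2 : ℝ) ^ (-(n : ℤ) * J) * φ (((2 : ℝ) ^ (-J) : ℝ) • v))
                (ContinuousLinearMap.mul ℝ ℝ) volume u -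
              convolution x
                (fun v => (2 : ℝ) ^ (-(n : ℤ) * J) * φ (((2 : ℝ) ^ (-J) : ℝ) • v))
                (ContinuousLinearMap.mul ℝ ℝ) volume u) 2
              (volume : Measure (EuclideanSpace ℝ (Fin n))) ≤
            ENNReal.ofReal C *
              (ENNReal.ofReal ((2 : ℝ) ^ (-J)) * (⨆ u, (‖g u‖₊ : ℝ≥0∞)) +
                (⨆ u, (‖fderiv ℝ g u‖₊ : ℝ≥0∞))) *
              eLpNorm x 2 (volume : Measure (EuclideanSpace ℝ (Fin n))) := by
  obtain ⟨L₀, hL₀⟩ := hφ.lipschitzWith_of_hasCompactSupport (𝕂 := ℝ) hφc one_ne_zero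
  obtain ⟨K₀, hK₀⟩ := hφc.exists_bound_of_continuous hφ.continuous
  have hK₀0 : 0 ≤ K₀ := (norm_nonneg _).trans (hK₀ 0)
  obtain ⟨R, hR⟩ := hφc.isCompact.isBounded.subset_closedBall (0 : EuclideanSpace ℝ (Fin n))
  set B := Metric.closedBall (0 : EuclideanSpace ℝ (Fin n)) R
  have hBm : MeasurableSet B := Metric.isClosed_closedBall.measurableSet
  have hV : volume B ≠ ∞ := measure_closedBall_lt_top.ne
  refine ⟨(volume B).toReal * (L₀ + 2 ^ n * K₀) * (2 * 2 ^ n) + 1, by positivity, ?_⟩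
  intro J g hg hg' x hx
  have hs : (0 : ℝ) < 2 ^ (-J) := by positivity
  have hpow : (2 : ℝ) ^ (-(n : ℤ) * J) = (2 ^ (-J)) ^ n := by
    rw [← zpow_natCast, ← zpow_mul]
    congr 1
    ring
  rw [hpow]
  set s : ℝ := 2 ^ (-J)
  have hind (a : EuclideanSpace ℝ (Fin n)) : (0 : ℝ) ≤ B.indicator 1 a :=
    Set.indicator_nonneg (fun _ _ => zero_le_one) a
  have hW := lintegral_dilation_indicator volume hs hBm
  rw [finrank_euclideanSpace_fin] at hW
  have key := eLpNorm_convolution_comp_sub_id_sub_le (μ := volume) hg hg' hx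
    (k := fun v => s ^ n * φ (s • v)) (w := fun v => s ^ n * B.indicator 1 (s • v))
    (L := L₀ * s) (K := K₀)
    (continuous_const.mul (hφ.continuous.comp (continuous_const_smul s)))
    ((hφc.comp_smul hs.ne').mul_left)
    (((measurable_one.indicator hBm).comp (measurable_const_smul s)).const_mul _)
    (fun a => mul_nonneg (by positivity) (hind _)) (by positivity) hK₀0
    (fun a b => by
      have h := abs_sub_le_of_lipschitzWith_of_tsupport_subset hL₀ hR (s • a) (s • b)
      rw [← smul_sub, norm_smul, Real.norm_of_nonneg hs.le] at h
      rw [← mul_sub, abs_mul, abs_of_pos (pow_pos hs n)]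
      calc _ ≤ _ := mul_le_mul_of_nonneg_left h (pow_pos hs n).le
        _ = _ := by ring)
    (fun a => by
      have h := abs_le_mul_indicator_of_tsupport_subset hK₀ hR (s • a)
      rw [abs_mul, abs_of_pos (pow_pos hs n)]
      calc _ ≤ _ := mul_le_mul_of_nonneg_left h (pow_pos hs n).le
        _ = _ := by ring)
  refine key.trans ?_
  rw [hW, finrank_euclideanSpace_fin]
  simp only [← enorm_eq_nnnorm]
  set G := ⨆ u, ‖g u‖ₑ
  set D := ⨆ u, ‖fderiv ℝ g u‖ₑ
  gcongr ?_ * _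
  have hS : ENNReal.ofReal (L₀ * s) * G + ENNReal.ofReal (2 ^ n * K₀) * D ≤
      ENNReal.ofReal (L₀ + 2 ^ n * K₀) * (ENNReal.ofReal s * G + D) := by
    rw [ENNReal.ofReal_mul (by positivity), mul_assoc, mul_add]
    gcongr
    · exact le_add_of_nonneg_right (by positivity)
    · exact le_add_of_nonneg_left (by positivity)
  have hC : volume B * ENNReal.ofReal (L₀ + 2 ^ n * K₀) * (2 * 2 ^ n) ≤
      ENNReal.ofReal ((volume B).toReal * (L₀ + 2 ^ n * K₀) * (2 * 2 ^ n) + 1) := by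
    have h2 : (2 * 2 ^ n : ℝ≥0∞) = ENNReal.ofReal (2 * 2 ^ n) := by
      rw [ENNReal.ofReal_mul (by norm_num), ENNReal.ofReal_pow (by norm_num), ENNReal.ofReal_ofNat]
    rw [h2]
    nth_rewrite 1 [← ENNReal.ofReal_toReal hV]
    rw [← ENNReal.ofReal_mul (by positivity), ← ENNReal.ofReal_mul (by positivity)]
    exact ENNReal.ofReal_le_ofReal (by linarith)
  calc _ ≤ volume B * (ENNReal.ofReal (L₀ + 2 ^ n * K₀) * (ENNReal.ofReal s * G + D)) *
        (2 * 2 ^ n) := by gcongr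
    _ = volume B * ENNReal.ofReal (L₀ + 2 ^ n * K₀) * (2 * 2 ^ n) *
        (ENNReal.ofReal s * G + D) := by ring
    _ ≤ _ := by gcongr
end
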